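/- For the sets J and K associated with d = 3 and v = (1,−1,−1), the following congruences hold modulo 2 for every n ≥ 1: X_{3n} ≡ U_n; Y_{3n} ≡ U_n + V_n; X_{3n+1} ≡ W_{n+1}(U_n + V_n); Y_{3n+1} ≡ W_{n+1}V_n; X_{3n+2} ≡ W_{n+1}(U_{n+1} + V_{n+1}); Y_{3n+2} ≡ W_{n+1}V_{n+1}; Z_{3n} ≡ W_n(U_n + U_nV_n + V_n); Z_{3n+1} ≡ W_{n+1}(U_n + U_nV_n + V_n); Z_{3n+2} ≡ W_{n+1}. -/

import Mathlib

/-- `J` for `d = 3`, `v = (1,−1,−1)`: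
`{(3n+1)·3^{2k} − 1} ∪ {(3n+2)·3^{2k+1} − 1}`. -/
def J3 : Set ℕ :=
  {t | ∃ n k : ℕ, t + 1 = (3 * n + 1) * 3 ^ (2 * k)} ∪
  {t | ∃ n k : ℕ, t + 1 = (3 * n + 2) * 3 ^ (2 * k + 1)}

/-- `K` for `d = 3`, `v = (1,−1,−1)`:
`{(3n+2)·3^{2k} − 1} ∪ {(3n+1)·3^{2k+1} − 1}`. -/
def K3 : Set ℕ :=
  {t | ∃ n k : ℕ, t + 1 = (3 * n + 2) * 3 ^ (2 * k)} ∪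
  {t | ∃ n k : ℕ, t + 1 = (3 * n + 1) * 3 ^ (2 * k + 1)}

/-- The number of permutations `σ` of `{0,…,m−1}` with `i + σ(i) ∈ S` for all
`i ≠ l`. -/
noncomputable def permCount (S : Set ℕ) (m l : ℕ) : ℕ :=
  Nat.card {σ : Equiv.Perm (Fin m) //
    ∀ i : Fin m, (i : ℕ) ≠ l → ((i : ℕ) + ((σ i : Fin m) : ℕ)) ∈ S}

noncomputable def X (n : ℕ) : ℕ := ∑ i ∈ Finset.range n, permCount J3 n i
noncomputable def Y (n : ℕ) : ℕ := permCount J3 n n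
noncomputable def Z (n : ℕ) : ℕ := permCount J3 n (n - 1)
noncomputable def U (n : ℕ) : ℕ := ∑ i ∈ Finset.range n, permCount K3 n i
noncomputable def V (n : ℕ) : ℕ := permCount K3 n n
noncomputable def W (n : ℕ) : ℕ := permCount K3 n (n - 1)

open Matrix

section CharTwoDeterminants

variable {ι κ μ : Type*} [Fintype ι] [DecidableEq ι] [Fintype κ] [DecidableEq κ]
  [Fintype μ] [DecidableEq μ]

/-- The matrix `A` with an additional last column `c`, last row `r` and corner entry `δ`. -/
def border (A : Matrix ι ι (ZMod 2)) (c r : ι → ZMod 2) (δ : ZMod 2) :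
    Matrix (ι ⊕ Unit) (ι ⊕ Unit) (ZMod 2) :=
  fromBlocks A (of fun i _ => c i) (of fun _ j => r j) (of fun _ _ => δ)

theorem det_submatrix_left_perm (σ : Equiv.Perm ι) (M : Matrix ι ι (ZMod 2)) :
    (M.submatrix σ id).det = M.det := by
  rw [det_permute]
  rcases Int.units_eq_one_or (Equiv.Perm.sign σ) with h | h <;> simp [h, CharTwo.neg_eq]

theorem det_border (A : Matrix ι ι (ZMod 2)) (c r : ι → ZMod 2) (δ : ZMod 2) :
    (border A c r δ).det = δ * A.det + ∑ l, c l * (A.updateRow l r).det := by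
  rw [det_eq_sum_mul_adjugate_col _ (Sum.inr ()), Fintype.sum_sum_type, add_comm]
  congr 1
  · have h : (border A c r δ).updateRow (Sum.inr ()) (Pi.single (Sum.inr ()) 1) =
        fromBlocks A (of fun i _ => c i) 0 1 := by
      ext (i | i) (j | j) <;> simp [border, updateRow_apply]
    simp only [adjugate_apply, Fintype.sum_unique]
    rw [h, det_fromBlocks_zero₂₁]
    simp [border]
  · refine Finset.sum_congr rfl fun l _ => ?_
    have h : ((border A c r δ).updateRow (Sum.inl l) (Pi.single (Sum.inr ()) 1)).submatrix
        (Equiv.swap (Sum.inl l) (Sum.inr ())) id =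
        fromBlocks (A.updateRow l r) (of fun i _ => if i = l then δ else c i) 0 1 := by
      ext (i | i) (j | j)
      · by_cases hi : i = l
        · subst hi; simp [border, updateRow_apply]
        · rw [submatrix_apply, Equiv.swap_apply_of_ne_of_ne (by simpa using hi) (by simp)]
          simp [border, updateRow_apply, hi]
      · by_cases hi : i = l
        · subst hi; simp [border, updateRow_apply]
        · rw [submatrix_apply, Equiv.swap_apply_of_ne_of_ne (by simpa using hi) (by simp)]
          simp [border, updateRow_apply, hi]
      · simp [border, updateRow_apply]
      · simp [border, updateRow_apply]
    rw [adjugate_apply, ← det_submatrix_left_perm (Equiv.swap (Sum.inl l) (Sum.inr ())), h,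
      det_fromBlocks_zero₂₁]
    simp [border]

theorem det_border_one (A : Matrix ι ι (ZMod 2)) (c r : ι → ZMod 2) :
    (border A c r 1).det = A.det + (border A c r 0).det := by
  simp [det_border]

theorem det_border_single (A : Matrix ι ι (ZMod 2)) (l : ι) (r : ι → ZMod 2) :
    (border A (Pi.single l 1) r 0).det = (A.updateRow l r).det := by
  simp [det_border, Pi.single_apply]

/-- Schur complement of an involutory block. -/
theorem det_fromBlocks_of_mul_self (A : Matrix ι ι (ZMod 2)) (B : Matrix ι κ (ZMod 2))
    (C : Matrix κ ι (ZMod 2)) (D : Matrix κ κ (ZMod 2)) (hA : A * A = 1) :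
    (fromBlocks A B C D).det = (D - C * A * B).det := by
  let _ : Invertible A := ⟨A, hA, hA⟩
  have h : A.det * A.det = 1 := by rw [← det_mul, hA, det_one]
  have h1 : A.det = 1 := by
    generalize A.det = x at h
    revert x; decide
  rw [det_fromBlocks₁₁, h1, one_mul]
  rfl

theorem det_add_ones (A : Matrix ι ι (ZMod 2)) :
    (A + of fun _ _ => 1).det = A.det + (border A 1 1 0).det := by
  rw [← det_border_one, border,
    ← det_submatrix_equiv_self (Equiv.sumComm Unit ι), Equiv.sumComm_apply,
    fromBlocks_submatrix_sum_swap_sum_swap, det_fromBlocks_of_mul_self]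
  · congr 1
    ext i j
    simp [mul_apply, CharTwo.sub_eq_add]
  · ext; simp [mul_apply]

theorem det_fromBlocks_ones (A D : Matrix κ κ (ZMod 2)) :
    (fromBlocks A (of fun _ _ => 1) (of fun _ _ => 1) D).det =
      A.det * D.det + (border A 1 1 0).det * (border D 1 1 0).det := by
  let P : Matrix ((κ ⊕ Unit) ⊕ (κ ⊕ Unit)) ((κ ⊕ Unit) ⊕ (κ ⊕ Unit)) (ZMod 2) :=
    fromBlocks (border A 1 1 0) (fromBlocks 0 0 0 1) (fromBlocks 0 0 0 1) (border D 1 1 0)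
  have hP : P.det = (fromBlocks A (of fun _ _ => 1) (of fun _ _ => 1) D).det := by
    let S : Matrix ((Unit ⊕ Unit) ⊕ (κ ⊕ κ)) ((Unit ⊕ Unit) ⊕ (κ ⊕ κ)) (ZMod 2) :=
      fromBlocks (fromBlocks 0 1 1 0)
        (fromBlocks (of fun _ _ => 1) 0 0 (of fun _ _ => 1))
        (fromBlocks (of fun _ _ => 1) 0 0 (of fun _ _ => 1)) (fromBlocks A 0 0 D)
    have hS : P = S.submatrix
        ((Equiv.sumSumSumComm κ Unit κ Unit).trans (Equiv.sumComm _ _))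
        ((Equiv.sumSumSumComm κ Unit κ Unit).trans (Equiv.sumComm _ _)) := by
      ext ((i | i) | (i | i)) ((j | j) | (j | j)) <;> simp [P, S, border]
    rw [hS, det_submatrix_equiv_self, det_fromBlocks_of_mul_self]
    · congr 1
      ext (i | i) (j | j) <;> simp [fromBlocks_multiply, mul_apply, CharTwo.neg_eq]
    · simp [fromBlocks_multiply]
  have hrow : P = P.updateRow (Sum.inl (Sum.inr ()))
      ((Sum.elim (Sum.elim 1 0) 0 : (κ ⊕ Unit) ⊕ (κ ⊕ Unit) → ZMod 2) +
        Pi.single (Sum.inr (Sum.inr ())) 1) := by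
    ext ((i | i) | (i | i)) ((j | j) | (j | j)) <;> simp [P, border, updateRow_apply]
  have h1 : P.updateRow (Sum.inl (Sum.inr ())) (Sum.elim (Sum.elim 1 0) 0) =
      fromBlocks (border A 1 1 0) 0 (fromBlocks 0 0 0 1) (border D 1 1 0) := by
    ext ((i | i) | (i | i)) ((j | j) | (j | j)) <;> simp [P, border, updateRow_apply]
  have h2 : (P.updateRow (Sum.inl (Sum.inr ())) (Pi.single (Sum.inr (Sum.inr ())) 1)).submatrix
      (Equiv.swap (Sum.inl (Sum.inr ())) (Sum.inr (Sum.inr ()))) id =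
      fromBlocks (fromBlocks A (of fun _ _ => 1) 0 1) (fromBlocks 0 0 (of fun _ _ => 1) 0) 0
        (fromBlocks D (of fun _ _ => 1) 0 1) := by
    ext ((i | i) | (i | i)) ((j | j) | (j | j)) <;>
      simp [P, border, updateRow_apply, Equiv.swap_apply_def]
  rw [← hP, hrow, det_updateRow_add, h1,
    ← det_submatrix_left_perm (Equiv.swap (Sum.inl (Sum.inr ())) (Sum.inr (Sum.inr ())))
      (P.updateRow _ (Pi.single _ _)), h2]
  simp only [det_fromBlocks_zero₁₂, det_fromBlocks_zero₂₁, det_one, mul_one]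
  ring

theorem det_border_add_ones (A : Matrix κ κ (ZMod 2)) (c : κ → ZMod 2) (δ : ZMod 2) :
    (border (A + of fun _ _ => 1) (fun i => c i + δ) 1 δ).det = (border A c 1 δ).det := by
  have h : border (A + of fun _ _ => 1) (fun i => c i + δ) 1 δ =
      fromBlocks 1 (of fun _ _ => 1) 0 1 * border A c 1 δ := by
    ext (i | i) (j | j) <;> simp [border, mul_apply, one_apply]
  rw [h, det_mul, det_fromBlocks_zero₂₁]
  simp

theorem det_cyclic_blocks (B : Matrix κ κ (ZMod 2)) (c₀ c₁ c₂ : Matrix κ μ (ZMod 2))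
    (d : Matrix μ κ (ZMod 2)) (δ : Matrix μ μ (ZMod 2)) :
    (fromBlocks (fromBlocks (of fun _ _ => 1) 0 0 B)
      (fromBlocks B c₀ (of fun _ _ => 1) c₁) (fromBlocks B (of fun _ _ => 1) d d)
      (fromBlocks 0 c₂ d δ)).det =
    (B.det + (border B 1 1 0).det + B.det * (border B 1 1 0).det) *
      (fromBlocks (B + of fun _ _ => 1) (c₀ + c₁ + c₂) d δ).det := by
  set E : Matrix κ κ (ZMod 2) := of fun _ _ => 1 with hE
  let S : Matrix (κ ⊕ μ) (κ ⊕ κ) (ZMod 2) := fromBlocks 1 1 0 0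
  have key : (fromBlocks 1 0 S 1 : Matrix ((κ ⊕ κ) ⊕ (κ ⊕ μ)) ((κ ⊕ κ) ⊕ (κ ⊕ μ)) (ZMod 2)) *
      fromBlocks (fromBlocks E 0 0 B) (fromBlocks B c₀ E c₁) (fromBlocks B E d d)
      (fromBlocks 0 c₂ d δ) * fromBlocks 1 0 S 1 =
      fromBlocks (fromBlocks (B + E) B E (B + E)) (fromBlocks B c₀ E c₁) 0
        (fromBlocks (B + E) (c₀ + c₁ + c₂) d δ) := by
    simp only [fromBlocks_multiply]
    congr 1 <;> ext (i | i) (j | j) <;>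
      simp [S, fromBlocks_multiply, fromBlocks_add] <;> grind
  have hQ : (fromBlocks (B + E) B E (B + E)).det =
      B.det + (border B 1 1 0).det + B.det * (border B 1 1 0).det := by
    have hm : (fromBlocks 1 1 0 1 : Matrix (κ ⊕ κ) (κ ⊕ κ) (ZMod 2)) *
        fromBlocks (B + E) B E (B + E) = fromBlocks B E E (B + E) := by
      ext (i | i) (j | j) <;> simp [fromBlocks_multiply] <;> grind
    have hd := congrArg det hm
    have hb := det_border_add_ones B 1 0
    simp only [Pi.one_apply, add_zero] at hb
    simp only [det_mul, det_fromBlocks_zero₂₁, det_one, one_mul] at hd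
    rw [hd, hE, det_fromBlocks_ones, det_add_ones]
    change _ + _ * (border _ (fun _ => 1) 1 0).det = _
    rw [hb]
    generalize B.det = x
    generalize (border B 1 1 0).det = y
    revert x y; decide
  have hd := congrArg det key
  simp only [det_mul, det_fromBlocks_zero₂₁, det_fromBlocks_zero₁₂, det_one, one_mul, mul_one] at hd
  rw [hd, hQ]

/-- `M` factors through `diag(Tᵀ, 1, 1)` on the left and `diag(T, 1, 1)` on the right. -/
theorem det_corner_blocks (T : Matrix κ (κ ⊕ Unit) (ZMod 2)) (D : Matrix μ μ (ZMod 2))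
    (p q r : μ → ZMod 2) :
    (fromBlocks (fromBlocks (of fun _ _ => 1) Tᵀ T 0)
      (of fun i j => Sum.elim (fun _ => r j) (fun _ => q j) i)
      (of fun i j => Sum.elim (fun _ => p i) (fun _ => q i) j) D).det =
    (fromRows T (of fun (_ : Unit) _ => 1)).det * (D - of fun i j => p i * r j).det := by
  let G : Matrix ((κ ⊕ Unit) ⊕ κ) ((κ ⊕ Unit) ⊕ κ) (ZMod 2) :=
    fromBlocks (fromBlocks 0 0 0 1) (fromRows 1 0) (fromCols 1 0) 0
  let T' : Matrix (κ ⊕ Unit) (κ ⊕ Unit) (ZMod 2) := fromRows T (of fun _ _ => 1)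
  let N : Matrix ((κ ⊕ Unit) ⊕ κ) μ (ZMod 2) :=
    fromRows (fromRows 0 (of fun _ j => r j)) (of fun _ j => q j)
  let N' : Matrix μ ((κ ⊕ Unit) ⊕ κ) (ZMod 2) :=
    fromCols (fromCols 0 (of fun i _ => p i)) (of fun i _ => q i)
  have hG : G * G = 1 := by
    ext ((i | i) | i) ((j | j) | j) <;> simp [G, mul_apply, one_apply]
  have key : fromBlocks (fromBlocks (of fun _ _ => 1) Tᵀ T 0)
      (of fun i j => Sum.elim (fun _ => r j) (fun _ => q j) i)
      (of fun i j => Sum.elim (fun _ => p i) (fun _ => q i) j) D =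
      fromBlocks (fromBlocks T'ᵀ 0 0 1) 0 0 1 *
      fromBlocks G N N' D *
      fromBlocks (fromBlocks T' 0 0 1) 0 0 1 := by
    ext ((i | i) | i) ((j | j) | j) <;> simp [G, N, N', T', mul_apply, one_apply]
  have hS : D - N' * G * N = D - of fun i j => p i * r j := by
    ext i j; simp [G, N, N', mul_apply, one_apply]
  rw [key, det_mul, det_mul, det_fromBlocks_of_mul_self _ _ _ _ hG, hS]
  simp only [det_fromBlocks_zero₂₁, det_one, mul_one, det_transpose]
  change _ = T'.det * _
  have hidem (x y : ZMod 2) : x * y * x = x * y := by revert x y; decide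
  exact hidem _ _

end CharTwoDeterminants

section Hankel

open scoped Classical in
/-- The indicator function of `S` with values in `ZMod 2`. -/
noncomputable def ind (S : Set ℕ) (t : ℕ) : ZMod 2 := if t ∈ S then 1 else 0

/-- The matrix with entries `ind S (f i + f j)`, for a labelling `f` of the index type. -/
noncomputable def hankel {ι : Type*} (S : Set ℕ) (f : ι → ℕ) : Matrix ι ι (ZMod 2) :=
  of fun i j => ind S (f i + f j)

theorem permCount_cast (S : Set ℕ) (m l : ℕ) :
    (permCount S m l : ZMod 2) =
      (of fun i j : Fin m => if (i : ℕ) = l then 1 else ind S (i + j)).det := by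
  classical
  rw [permCount, Nat.card_eq_fintype_card, Fintype.card_subtype, Finset.card_filter,
    Nat.cast_sum]
  rw [← det_transpose (R := ZMod 2), det_apply]
  refine Finset.sum_congr rfl fun σ _ => ?_
  have h : ∏ i, (of fun i j : Fin m => if (i : ℕ) = l then 1 else ind S (i + j))ᵀ (σ i) i =
      if ∀ i : Fin m, (i : ℕ) ≠ l → (i : ℕ) + (σ i : ℕ) ∈ S then (1 : ZMod 2) else 0 := by
    have hi (i : Fin m) : (of fun i j : Fin m => if (i : ℕ) = l then 1 else ind S (i + j))ᵀ
        (σ i) i = if (i : ℕ) ≠ l → (i : ℕ) + (σ i : ℕ) ∈ S then (1 : ZMod 2) else 0 := by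
      by_cases hl : (i : ℕ) = l <;> simp [ind, hl]
    simp only [hi, Finset.prod_ite_zero, Finset.prod_const_one, Finset.mem_univ, forall_const]
  rw [h, Nat.cast_ite, Nat.cast_one, Nat.cast_zero]
  rcases Int.units_eq_one_or (Equiv.Perm.sign σ) with hs | hs <;>
    simp [hs, Units.smul_def, CharTwo.neg_eq]

theorem exists_equiv_fin {ι : Type*} [Fintype ι] {m : ℕ} (f : ι → ℕ) (hf : f.Injective) (hlt : ∀ i, f i < m)
    (hc : Fintype.card ι = m) : ∃ e : ι ≃ Fin m, ∀ i, (e i : ℕ) = f i :=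
  ⟨Equiv.ofBijective (fun i => ⟨f i, hlt i⟩) <| (Fintype.bijective_iff_injective_and_card _).2
    ⟨fun i j h => hf (congrArg Fin.val h), by simpa using hc⟩, fun _ => rfl⟩

variable {ι : Type*} [Fintype ι] [DecidableEq ι]

theorem permCount_self_cast {m : ℕ} (S : Set ℕ) (f : ι → ℕ) (hf : f.Injective)
    (hlt : ∀ i, f i < m) (hc : Fintype.card ι = m) :
    (permCount S m m : ZMod 2) = (hankel S f).det := by
  obtain ⟨e, he⟩ := exists_equiv_fin f hf hlt hc
  rw [permCount_cast, ← det_submatrix_equiv_self e]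
  congr 1
  ext i j
  simp [hankel, he, (hlt i).ne]

theorem permCount_apply_cast {m : ℕ} (S : Set ℕ) (f : ι → ℕ) (hf : f.Injective)
    (hlt : ∀ i, f i < m) (hc : Fintype.card ι = m) (l : ι) :
    (permCount S m (f l) : ZMod 2) = ((hankel S f).updateRow l 1).det := by
  obtain ⟨e, he⟩ := exists_equiv_fin f hf hlt hc
  rw [permCount_cast, ← det_submatrix_equiv_self e]
  congr 1
  ext i j
  simp [hankel, he, updateRow_apply, hf.eq_iff]

theorem sum_permCount_cast {m : ℕ} (S : Set ℕ) (f : ι → ℕ) (hf : f.Injective)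
    (hlt : ∀ i, f i < m) (hc : Fintype.card ι = m) :
    ((∑ i ∈ Finset.range m, permCount S m i : ℕ) : ZMod 2) =
      (border (hankel S f) 1 1 0).det := by
  obtain ⟨e, he⟩ := exists_equiv_fin f hf hlt hc
  rw [det_border, Finset.sum_range, ← e.sum_comp]
  simp [he, permCount_apply_cast S f hf hlt hc]

theorem three_mul_mem_J3 (p : ℕ) : 3 * p ∈ J3 := Or.inl ⟨p, 0, by simp⟩

theorem three_mul_add_one_notMem_J3 (p : ℕ) : 3 * p + 1 ∉ J3 := by
  rintro (⟨n, k, h⟩ | ⟨n, k, h⟩)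
  · rcases k with - | k
    · simp at h; omega
    · rw [show 2 * (k + 1) = 2 * k + 1 + 1 by ring, pow_succ] at h
      grind
  · rw [pow_succ] at h
    grind

theorem three_mul_add_two_mem_J3_iff (p : ℕ) : 3 * p + 2 ∈ J3 ↔ p ∈ K3 := by
  constructor
  · rintro (⟨n, k, h⟩ | ⟨n, k, h⟩)
    · rcases k with - | k
      · simp at h; omega
      · refine Or.inr ⟨n, k, ?_⟩
        rw [show 2 * (k + 1) = 2 * k + 1 + 1 by ring, pow_succ] at h
        linarith
    · refine Or.inl ⟨n, k, ?_⟩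
      rw [pow_succ] at h
      linarith
  · rintro (⟨n, k, h⟩ | ⟨n, k, h⟩)
    · refine Or.inr ⟨n, k, ?_⟩
      rw [pow_succ]
      linarith
    · refine Or.inl ⟨n, k + 1, ?_⟩
      rw [show 2 * (k + 1) = 2 * k + 1 + 1 by ring, pow_succ]
      linarith

theorem ind_J3_three_mul (p : ℕ) : ind J3 (3 * p) = 1 := by
  simp [ind, three_mul_mem_J3]

theorem ind_J3_three_mul_add_one (p : ℕ) : ind J3 (3 * p + 1) = 0 := by
  simp [ind, three_mul_add_one_notMem_J3]

theorem ind_J3_three_mul_add_two (p : ℕ) : ind J3 (3 * p + 2) = ind K3 p := by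
  by_cases h : p ∈ K3 <;> simp [ind, three_mul_add_two_mem_J3_iff, h]

theorem ind_J3_add (x y : ℕ) :
    ind J3 (3 * x + 3 * y) = 1 ∧ ind J3 (3 * x + (3 * y + 1)) = 0 ∧
    ind J3 (3 * x + (3 * y + 2)) = ind K3 (x + y) ∧
    ind J3 (3 * x + 1 + 3 * y) = 0 ∧ ind J3 (3 * x + 1 + (3 * y + 1)) = ind K3 (x + y) ∧
    ind J3 (3 * x + 1 + (3 * y + 2)) = 1 ∧
    ind J3 (3 * x + 2 + 3 * y) = ind K3 (x + y) ∧ ind J3 (3 * x + 2 + (3 * y + 1)) = 1 ∧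
    ind J3 (3 * x + 2 + (3 * y + 2)) = 0 := by
  have h0 := ind_J3_three_mul (x + y)
  have h1 := ind_J3_three_mul_add_one (x + y)
  have h2 := ind_J3_three_mul_add_two (x + y)
  have h3 := ind_J3_three_mul (x + y + 1)
  have h4 := ind_J3_three_mul_add_one (x + y + 1)
  refine ⟨?_, ?_, ?_, ?_, ?_, ?_, ?_, ?_, ?_⟩ <;>
    first
    | exact Eq.trans (congrArg _ (by omega)) h0
    | exact Eq.trans (congrArg _ (by omega)) h1
    | exact Eq.trans (congrArg _ (by omega)) h2
    | exact Eq.trans (congrArg _ (by omega)) h3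
    | exact Eq.trans (congrArg _ (by omega)) h4

end Hankel

section Recurrences

variable {κ μ : Type*} [Fintype κ] [DecidableEq κ] [Fintype μ] [DecidableEq μ]

theorem det_border_hankel_J3_cyclic (f : κ → ℕ) (c₀ c₁ c₂ d : κ → ZMod 2) (δ : ZMod 2) :
    (border (hankel J3 (Sum.elim (Sum.elim (3 * f ·) (3 * f · + 1)) (3 * f · + 2)))
      (Sum.elim (Sum.elim c₀ c₁) c₂) (Sum.elim (Sum.elim d d) d) δ).det =
    ((hankel K3 f).det + (border (hankel K3 f) 1 1 0).det +
      (hankel K3 f).det * (border (hankel K3 f) 1 1 0).det) *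
      (border (hankel K3 f + of fun _ _ => 1) (c₀ + c₁ + c₂) d δ).det := by
  rw [border, ← det_submatrix_equiv_self (Equiv.sumAssoc (κ ⊕ κ) κ Unit).symm]
  convert det_cyclic_blocks (hankel K3 f) (of fun i (_ : Unit) => c₀ i) (of fun i _ => c₁ i)
    (of fun i _ => c₂ i) (of fun _ j => d j) (of fun _ _ => δ) using 2
  · ext ((i | i) | (i | i)) ((j | j) | (j | j)) <;> simp [hankel, ind_J3_add]
  · rfl

omit [Fintype κ] [DecidableEq κ] [Fintype μ] [DecidableEq μ] in
theorem hankel_J3_corner (f : κ → ℕ) (a : ℕ) (g : μ → ℕ) :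
    hankel J3 (Sum.elim (Sum.elim (fun i => 3 * Sum.elim f (fun _ : Unit => a) i)
      (3 * f · + 2)) (3 * g · + 1)) =
    fromBlocks (fromBlocks (of fun _ _ => 1)
        (of fun i j => ind K3 (f i + Sum.elim f (fun _ => a) j))ᵀ
        (of fun i j => ind K3 (f i + Sum.elim f (fun _ => a) j)) 0)
      (of fun i _ => Sum.elim (fun _ => 0) (fun _ => 1) i)
      (of fun _ j => Sum.elim (fun _ => 0) (fun _ => 1) j) (hankel K3 g) := by
  ext ((i | i) | i) ((j | j) | j) <;> simp [hankel, ind_J3_add]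
  rw [add_comm]

theorem det_hankel_K3_updateRow (f : κ → ℕ) (a : ℕ) :
    ((hankel K3 (Sum.elim f fun _ : Unit => a)).updateRow (Sum.inr ()) 1).det =
      (fromRows (of fun i j => ind K3 (f i + Sum.elim f (fun _ => a) j))
        (of fun (_ : Unit) _ => 1)).det := by
  congr 1
  ext (i | i) j <;> simp [hankel, updateRow_apply]

theorem det_hankel_J3_corner (f : κ → ℕ) (a : ℕ) (g : μ → ℕ) :
    (hankel J3 (Sum.elim (Sum.elim (fun i => 3 * Sum.elim f (fun _ : Unit => a) i)
      (3 * f · + 2)) (3 * g · + 1))).det =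
    ((hankel K3 (Sum.elim f fun _ : Unit => a)).updateRow (Sum.inr ()) 1).det *
      (hankel K3 g).det := by
  rw [hankel_J3_corner, det_hankel_K3_updateRow]
  convert det_corner_blocks _ _ (fun _ => 0) (fun _ => 1) (fun _ => 0) using 3
  ext; simp

theorem det_border_hankel_J3_corner (f : κ → ℕ) (a : ℕ) (g : μ → ℕ) :
    (border (hankel J3 (Sum.elim (Sum.elim (fun i => 3 * Sum.elim f (fun _ : Unit => a) i)
      (3 * f · + 2)) (3 * g · + 1))) 1 1 0).det =
    ((hankel K3 (Sum.elim f fun _ : Unit => a)).updateRow (Sum.inr ()) 1).det *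
      ((hankel K3 g).det + (border (hankel K3 g) 1 1 0).det) := by
  rw [border, hankel_J3_corner, det_hankel_K3_updateRow, ← det_border_one,
    ← det_submatrix_equiv_self (Equiv.sumAssoc ((κ ⊕ Unit) ⊕ κ) μ Unit).symm]
  convert det_corner_blocks _ (border (hankel K3 g) 1 1 0)
    (Sum.elim 0 1) (fun _ => 1) (Sum.elim 0 1) using 2
  · ext ((i | i) | (i | i)) ((j | j) | (j | j)) <;> simp [border]
  · congr 1
    ext (i | i) (j | j) <;> simp [border, CharTwo.neg_eq]

theorem det_hankel_J3_updateRow_corner (f : κ → ℕ) (a : ℕ) :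
    ((hankel J3 (Sum.elim (Sum.elim (fun i => 3 * Sum.elim f (fun _ : Unit => a) i)
      (3 * f · + 2)) (3 * Sum.elim f (fun _ : Unit => a) · + 1))).updateRow
        (Sum.inr (Sum.inr ())) 1).det =
    ((hankel K3 (Sum.elim f fun _ : Unit => a)).updateRow (Sum.inr ()) 1).det := by
  have hsq (x : ZMod 2) : x = x * x := by revert x; decide
  rw [hankel_J3_corner]
  refine Eq.trans ?_ (hsq _).symm
  nth_rw 1 [det_hankel_K3_updateRow]
  convert det_corner_blocks _ ((hankel K3 (Sum.elim f fun _ : Unit => a)).updateRow (Sum.inr ()) 1)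
    (Sum.elim 0 1) (fun _ => 1) 0 using 2
  · ext ((i | i) | (i | i)) ((j | j) | (j | j)) <;> simp [updateRow_apply]
  · congr 1
    ext; simp

end Recurrences

/-- Recurrences mod 2 expressing `X, Y, Z` in terms of `U, V, W`. -/
theorem F3_recurrences_XYZ :
    ∀ n : ℕ, 1 ≤ n →
      X (3 * n) ≡ U n [MOD 2] ∧
      Y (3 * n) ≡ U n + V n [MOD 2] ∧
      X (3 * n + 1) ≡ W (n + 1) * (U n + V n) [MOD 2] ∧
      Y (3 * n + 1) ≡ W (n + 1) * V n [MOD 2] ∧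
      X (3 * n + 2) ≡ W (n + 1) * (U (n + 1) + V (n + 1)) [MOD 2] ∧
      Y (3 * n + 2) ≡ W (n + 1) * V (n + 1) [MOD 2] ∧
      Z (3 * n) ≡ W n * (U n + U n * V n + V n) [MOD 2] ∧
      Z (3 * n + 1) ≡ W (n + 1) * (U n + U n * V n + V n) [MOD 2] ∧
      Z (3 * n + 2) ≡ W (n + 1) [MOD 2] := by
  intro n hn
  simp only [← ZMod.natCast_eq_natCast_iff, Nat.cast_mul, Nat.cast_add]
  let f : Fin n → ℕ := Fin.val
  have hf : f.Injective := Fin.val_injective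
  let g : Fin n ⊕ Unit → ℕ := Sum.elim f fun _ => n
  have hg : g.Injective := by
    rintro (i | i) (j | j) h <;> simp [g, f] at h ⊢ <;> omega
  have hglt : ∀ i, g i < n + 1 := by
    rintro (i | i) <;> simp [g, f]
  let F₀ : (Fin n ⊕ Fin n) ⊕ Fin n → ℕ :=
    Sum.elim (Sum.elim (3 * f ·) (3 * f · + 1)) (3 * f · + 2)
  have hF₀ : F₀.Injective := by
    rintro ((i | i) | i) ((j | j) | j) h <;> simp [F₀, f] at h ⊢ <;> omega
  have hF₀lt : ∀ i, F₀ i < 3 * n := by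
    rintro ((i | i) | i) <;> simp [F₀, f] <;> omega
  have hF₀c : Fintype.card ((Fin n ⊕ Fin n) ⊕ Fin n) = 3 * n := by simp; ring
  let F₁ : ((Fin n ⊕ Unit) ⊕ Fin n) ⊕ Fin n → ℕ :=
    Sum.elim (Sum.elim (3 * g ·) (3 * f · + 2)) (3 * f · + 1)
  have hF₁ : F₁.Injective := by
    rintro (((i | i) | i) | i) (((j | j) | j) | j) h <;> simp [F₁, f, g] at h ⊢ <;> omega
  have hF₁lt : ∀ i, F₁ i < 3 * n + 1 := by
    rintro (((i | i) | i) | i) <;> simp [F₁, f, g] <;> omega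
  have hF₁c : Fintype.card (((Fin n ⊕ Unit) ⊕ Fin n) ⊕ Fin n) = 3 * n + 1 := by simp; ring
  let F₂ : ((Fin n ⊕ Unit) ⊕ Fin n) ⊕ (Fin n ⊕ Unit) → ℕ :=
    Sum.elim (Sum.elim (3 * g ·) (3 * f · + 2)) (3 * g · + 1)
  have hF₂ : F₂.Injective := by
    rintro (((i | i) | i) | (i | i)) (((j | j) | j) | (j | j)) h <;>
      simp [F₂, f, g] at h ⊢ <;> omega
  have hF₂lt : ∀ i, F₂ i < 3 * n + 2 := by
    rintro (((i | i) | i) | (i | i)) <;> simp [F₂, f, g] <;> omega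
  have hF₂c : Fintype.card (((Fin n ⊕ Unit) ⊕ Fin n) ⊕ (Fin n ⊕ Unit)) = 3 * n + 2 := by
    simp; ring
  let F₃ : ((Fin n ⊕ Fin n) ⊕ Fin n) ⊕ Unit → ℕ := Sum.elim F₀ fun _ => 3 * n
  have hF₃ : F₃.Injective := by
    rintro (((i | i) | i) | i) (((j | j) | j) | j) h <;> simp [F₃, F₀, f] at h ⊢ <;> omega
  have hF₃lt : ∀ i, F₃ i < 3 * n + 1 := by
    rintro (((i | i) | i) | i) <;> simp [F₃, F₀, f] <;> omega
  have hF₃c : Fintype.card (((Fin n ⊕ Fin n) ⊕ Fin n) ⊕ Unit) = 3 * n + 1 := by simp; ring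
  let l : Fin n := ⟨n - 1, by omega⟩
  have hU : (U n : ZMod 2) = (border (hankel K3 f) 1 1 0).det :=
    sum_permCount_cast K3 f hf (fun i => i.2) (Fintype.card_fin n)
  have hV : (V n : ZMod 2) = (hankel K3 f).det :=
    permCount_self_cast K3 f hf (fun i => i.2) (Fintype.card_fin n)
  have hW : (W n : ZMod 2) = ((hankel K3 f).updateRow l 1).det :=
    permCount_apply_cast K3 f hf (fun i => i.2) (Fintype.card_fin n) l
  have hU' : (U (n + 1) : ZMod 2) = (border (hankel K3 g) 1 1 0).det :=
    sum_permCount_cast K3 g hg hglt (by simp)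
  have hV' : (V (n + 1) : ZMod 2) = (hankel K3 g).det :=
    permCount_self_cast K3 g hg hglt (by simp)
  have hW' : (W (n + 1) : ZMod 2) = ((hankel K3 g).updateRow (Sum.inr ()) 1).det :=
    permCount_apply_cast K3 g hg hglt (by simp) (Sum.inr ())
  have hidem (x y : ZMod 2) : (x + y + x * y) * (x + y) = x + y ∧
      (x + y + x * y) * y = y := by revert x y; decide
  refine ⟨?_, ?_, ?_, ?_, ?_, ?_, ?_, ?_, ?_⟩
  · rw [X, sum_permCount_cast J3 F₀ hF₀ hF₀lt hF₀c, hU]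
    have h := det_border_hankel_J3_cyclic f 1 1 1 1 0
    have h1 := det_border_add_ones (hankel K3 f) 1 0
    simp only [Sum.elim_one_one] at h
    simp only [Pi.one_apply, add_zero] at h1
    change _ = _ * (border _ (fun _ => 1) 1 0).det at h
    rw [h1, (hidem _ _).2] at h
    exact h
  · rw [Y, permCount_self_cast J3 F₀ hF₀ hF₀lt hF₀c, hU, hV]
    have h := det_border_hankel_J3_cyclic f 0 0 0 0 1
    simp only [det_border _ 0, det_add_ones, Sum.elim_zero_zero, Pi.zero_apply, zero_mul,
      one_mul, Finset.sum_const_zero, add_zero] at h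
    rw [(hidem _ _).1, add_comm] at h
    exact h
  · rw [X, sum_permCount_cast J3 F₁ hF₁ hF₁lt hF₁c, hU, hV, hW', add_comm]
    exact det_border_hankel_J3_corner f n f
  · rw [Y, permCount_self_cast J3 F₁ hF₁ hF₁lt hF₁c, hV, hW']
    exact det_hankel_J3_corner f n f
  · rw [X, sum_permCount_cast J3 F₂ hF₂ hF₂lt hF₂c, hU', hV', hW', add_comm]
    exact det_border_hankel_J3_corner f n g
  · rw [Y, permCount_self_cast J3 F₂ hF₂ hF₂lt hF₂c, hV', hW']
    exact det_hankel_J3_corner f n g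
  · have hl : 3 * n - 1 = F₀ (Sum.inr l) := by simp [F₀, f, l]; omega
    rw [Z, hl, permCount_apply_cast J3 F₀ hF₀ hF₀lt hF₀c, hU, hV, hW, ← det_border_single,
      ← det_border_single]
    have h := det_border_hankel_J3_cyclic f 0 0 (Pi.single l 1) 1 0
    have h1 := det_border_add_ones (hankel K3 f) (Pi.single l 1) 0
    simp only [add_zero, zero_add, Sum.elim_zero_zero, Sum.elim_one_one,
      Sum.elim_zero_single] at h h1
    rw [h1] at h
    refine h.trans ?_
    ring
  · rw [Z, show 3 * n + 1 - 1 = F₃ (Sum.inr ()) from rfl,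
      permCount_apply_cast J3 F₃ hF₃ hF₃lt hF₃c, hU, hV, hW']
    have h := det_border_hankel_J3_cyclic f 1 0 (fun i => ind K3 (f i + n)) 1 1
    have h1 := det_border_add_ones (hankel K3 f) (fun i => ind K3 (f i + n)) 1
    have h2 : (hankel J3 F₃).updateRow (Sum.inr ()) 1 =
        border (hankel J3 F₀) (Sum.elim (Sum.elim 1 0) fun i => ind K3 (f i + n))
          (Sum.elim (Sum.elim 1 1) 1) 1 := by
      ext (((i | i) | i) | i) (((j | j) | j) | j) <;>
        simp [hankel, border, F₃, F₀, updateRow_apply, ind_J3_add]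
    have h3 : (hankel K3 g).updateRow (Sum.inr ()) 1 =
        border (hankel K3 f) (fun i => ind K3 (f i + n)) 1 1 := by
      ext (i | i) (j | j) <;> simp [hankel, border, g, updateRow_apply]
    have h4 : (1 + 0 + fun i => ind K3 (f i + n)) = fun i => ind K3 (f i + n) + (1 : ZMod 2) := by
      ext i; simp [add_comm]
    rw [h2, h3, h, h4, h1]
    ring
  · rw [Z, show 3 * n + 2 - 1 = F₂ (Sum.inr (Sum.inr ())) from rfl,
      permCount_apply_cast J3 F₂ hF₂ hF₂lt hF₂c, hW']
    exact det_hankel_J3_updateRow_corner f n
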